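/- arXiv:1612.05772 — 3 statements merged into one kernel-verified Lean document; each statement's English description precedes it below -/
import Mathlib

section
/- For every natural number n ≥ 3, the Grundy value of the 0.33 game played on the cycle C_n (the cycle graph with n vertices) equals n mod 3. -/
open SimpleGraph

/-- The minimum excludant of a set of naturals. -/
noncomputable def mex (A : Set ℕ) : ℕ := sInf {n : ℕ | n ∉ A}

/-- The connected component (as a vertex set) of `x` in the subgraph of `G`
induced on the vertex set `s`. -/
def compOf {V : Type} (G : SimpleGraph V) (s : Set V) (x : V) : Set V :=
  {v | ∃ (hx : x ∈ s) (hv : v ∈ s), (G.induce s).Reachable ⟨x, hx⟩ ⟨v, hv⟩}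

/-- A legal move of the 0.33 game on the graph `G`, from the position (vertex set) `s`
to the position `t`: one removes either a single vertex of `s`, or two vertices of `s`
that are adjacent in `G`, and the removed set may not disconnect the connected component
`H` (of the subgraph induced on `s`) containing it: `H` minus the removed set must be
connected or empty. -/
def ValidMove {V : Type} [DecidableEq V] (G : SimpleGraph V) (s t : Finset V) : Prop :=
  t ⊆ s ∧
  ((∃ x ∈ s, s \ t = {x}) ∨ (∃ x ∈ s, ∃ y ∈ s, G.Adj x y ∧ s \ t = {x, y})) ∧
  ∀ x ∈ s \ t,
    (compOf G (↑s) x \ (↑(s \ t) : Set V) = ∅ ∨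
     (G.induce (compOf G (↑s) x \ (↑(s \ t) : Set V))).Connected)

theorem ValidMove.card_lt {V : Type} [DecidableEq V] {G : SimpleGraph V} {s t : Finset V}
    (h : ValidMove G s t) : t.card < s.card := by
  apply Finset.card_lt_card
  rw [Finset.ssubset_iff_of_subset h.1]
  rcases h.2.1 with ⟨x, hx, he⟩ | ⟨x, hx, y, hy, _, he⟩
  · refine ⟨x, hx, fun hxt => ?_⟩
    have hmem : x ∈ s \ t := by rw [he]; exact Finset.mem_singleton_self x
    exact (Finset.mem_sdiff.mp hmem).2 hxt
  · refine ⟨x, hx, fun hxt => ?_⟩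
    have hmem : x ∈ s \ t := by rw [he]; simp
    exact (Finset.mem_sdiff.mp hmem).2 hxt

/-- The Grundy value of the 0.33 game on the graph `G` played on the vertex set `s`. -/
noncomputable def grundy {V : Type} [DecidableEq V] (G : SimpleGraph V) (s : Finset V) : ℕ :=
  mex {n : ℕ | ∃ t : {t : Finset V // ValidMove G s t}, grundy G t.1 = n}
termination_by s.card
decreasing_by exact t.2.card_lt

/-! ### Concrete graphs

`pathG` played on `Finset.range n` is the path `P_n`;
`cycleG n` played on `Finset.range n` is the cycle `C_n`.

Subdivided stars and bistars are encoded on vertex type `ℕ × ℕ`.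
A subdivided star is given by the list `L` of the numbers of vertices of its arms
(`some L`), or is the empty graph (`none`).
In the bistar `S₁ •m• S₂`, the center of `S₁` is `(0,0)`, the middle path consists of
`(1,1), …, (1,m)` where `(1,m)` is the center of `S₂` (when `m = 0` the two centers are
identified to `(0,0)`), the `i`-th arm of `S₁` consists of `(2i+2, 1), …, (2i+2, ℓᵢ)`,
and the `i`-th arm of `S₂` consists of `(2i+3, 1), …, (2i+3, ℓ'ᵢ)`.  If `S₂` is the
empty graph, its center `(1,m)` is removed (so `S₁` just gets an extra arm with `m-1`
vertices), and similarly for `S₁`. -/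

def pathG : SimpleGraph ℕ := SimpleGraph.fromRel (fun u v => v = u + 1)

def cycleG (n : ℕ) : SimpleGraph ℕ := SimpleGraph.fromRel (fun u v => v % n = (u + 1) % n)

def bistarG (m : ℕ) : SimpleGraph (ℕ × ℕ) :=
  SimpleGraph.fromRel (fun u v =>
    (u = (0, 0) ∧ v = (1, 1)) ∨
    (u.1 = 1 ∧ v.1 = 1 ∧ v.2 = u.2 + 1) ∨
    (u = (0, 0) ∧ 2 ≤ v.1 ∧ v.1 % 2 = 0 ∧ v.2 = 1) ∨
    (u = (if m = 0 then ((0 : ℕ), (0 : ℕ)) else (1, m)) ∧ 3 ≤ v.1 ∧ v.1 % 2 = 1 ∧ v.2 = 1) ∨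
    (u.1 = v.1 ∧ 2 ≤ u.1 ∧ v.2 = u.2 + 1))

def armVerts (base : ℕ) (L : List ℕ) : Finset (ℕ × ℕ) :=
  (Finset.range L.length).biUnion
    (fun i => (Finset.range (L.getD i 0)).image (fun j => (2 * i + base, j + 1)))

def bistarVerts (S1 S2 : Option (List ℕ)) (m : ℕ) : Finset (ℕ × ℕ) :=
  (match S1 with
   | none => (∅ : Finset (ℕ × ℕ))
   | some L => insert ((0 : ℕ), (0 : ℕ)) (armVerts 2 L)) ∪
  (match S2 with
   | none => (Finset.range (m - 1)).image (fun p => ((1 : ℕ), p + 1))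
   | some L => ((Finset.range m).image (fun p => ((1 : ℕ), p + 1))) ∪ armVerts 3 L)

/-- Grundy value of the 0.33 game on the subdivided bistar `S₁ •m• S₂`
(where `S₁`, `S₂` are subdivided stars or the empty graph). -/
noncomputable def bistarGrundyO (S1 S2 : Option (List ℕ)) (m : ℕ) : ℕ :=
  grundy (bistarG m) (bistarVerts S1 S2 m)

/-- Grundy value of the 0.33 game on the subdivided bistar `S_{L₁} •m• S_{L₂}`. -/
noncomputable def bistarGrundy (L1 L2 : List ℕ) (m : ℕ) : ℕ :=
  bistarGrundyO (some L1) (some L2) m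

/-- Grundy value of the 0.33 game on the subdivided star `S_L`. -/
noncomputable def starGrundy (L : List ℕ) : ℕ := bistarGrundy L [] 0

/-- Grundy value of the 0.33 game on a subdivided star or the empty graph. -/
noncomputable def starGrundyO (S : Option (List ℕ)) : ℕ := bistarGrundyO S (some []) 0

theorem mex_eq {A : Set ℕ} {n : ℕ} (hn : n ∉ A) (hlt : ∀ m < n, m ∈ A) : mex A = n := by
  refine le_antisymm (Nat.sInf_le hn) (le_csInf ⟨n, hn⟩ fun m hm => ?_)
  by_contra! h
  exact hm (hlt m h)

theorem compOf_eq_of_preconnected {V : Type} {G : SimpleGraph V} {s : Set V}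
    (hs : (G.induce s).Preconnected) {x : V} (hx : x ∈ s) : compOf G s x = s := by
  ext v
  exact ⟨fun ⟨_, hv, _⟩ => hv, fun hv => ⟨hx, hv, hs _ _⟩⟩

theorem induce_coe_preconnected_iff {V : Type} {G : SimpleGraph V} {t : Set V} :
    (G.induce t).Preconnected ↔ t = ∅ ∨ (G.induce t).Connected := by
  rcases t.eq_empty_or_nonempty with rfl | h
  · simp only [true_or, iff_true]
    exact fun x => x.2.elim
  · have := h.to_subtype
    simp [connected_iff, h.ne_empty, this]

theorem validMove_iff_of_preconnected {V : Type} [DecidableEq V] {G : SimpleGraph V}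
    {s t : Finset V} (hs : (G.induce (s : Set V)).Preconnected) :
    ValidMove G s t ↔ t ⊆ s ∧
      ((∃ x ∈ s, s \ t = {x}) ∨ (∃ x ∈ s, ∃ y ∈ s, G.Adj x y ∧ s \ t = {x, y})) ∧
      (G.induce (t : Set V)).Preconnected := by
  refine and_congr_right fun hts => and_congr_right fun hr => ?_
  have key : ∀ x ∈ s \ t, compOf G (↑s) x \ (↑(s \ t) : Set V) = t := fun x hx => by
    rw [compOf_eq_of_preconnected hs (Finset.mem_coe.2 (Finset.mem_sdiff.1 hx).1),
      ← Finset.coe_sdiff, Finset.sdiff_sdiff_eq_self hts]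
  obtain ⟨x, hx⟩ : (s \ t).Nonempty := by
    rcases hr with ⟨x, -, h⟩ | ⟨x, -, y, -, -, h⟩ <;> simp [h]
  rw [induce_coe_preconnected_iff]
  exact ⟨fun h => key x hx ▸ h x hx, fun h x hx => (key x hx).symm ▸ h⟩

theorem induce_preconnected_of_isChain {V : Type} {G : SimpleGraph V} (l : List V)
    (h : l.IsChain G.Adj) : (G.induce {v | v ∈ l}).Preconnected := by
  induction l with
  | nil => exact fun x => absurd x.2 List.not_mem_nil
  | cons a l ih =>
    cases l with
    | nil =>
      rintro ⟨x, hx⟩ ⟨y, hy⟩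
      obtain rfl : x = a := by simpa using hx
      obtain rfl : y = x := by simpa using hy
      rfl
    | cons b l =>
      rw [List.isChain_cons_cons] at h
      have hsub : {v | v ∈ b :: l} ⊆ {v | v ∈ a :: b :: l} := fun v hv => List.mem_cons_of_mem _ hv
      have hb : b ∈ {v | v ∈ a :: b :: l} := by simp
      suffices H : ∀ x : {v | v ∈ a :: b :: l},
          (G.induce {v | v ∈ a :: b :: l}).Reachable x ⟨b, hb⟩ from
        fun x y => (H x).trans (H y).symm
      rintro ⟨x, hx⟩
      rcases List.mem_cons.1 hx with rfl | hx'
      · exact Adj.reachable (by simpa using h.1)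
      · exact (ih h.2 ⟨x, hx'⟩ ⟨b, by simp⟩).map (induceHomOfLE G hsub).toHom

/-- A finite connected graph of maximum degree at most two has a Hamiltonian path. -/
theorem exists_isChain_toFinset_eq {V : Type} [DecidableEq V] {G : SimpleGraph V} {s : Finset V}
    (hdeg : ∀ v ∈ s, ∀ a ∈ s, ∀ b ∈ s, ∀ c ∈ s, G.Adj v a → G.Adj v b → G.Adj v c →
      a = b ∨ a = c ∨ b = c)
    (hs : (G.induce (s : Set V)).Preconnected) :
    ∃ l : List V, l.Nodup ∧ l.IsChain G.Adj ∧ l.toFinset = s := by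
  let P : ℕ → Prop := fun k =>
    ∃ l : List V, l.Nodup ∧ l.IsChain G.Adj ∧ (∀ v ∈ l, v ∈ s) ∧ l.length = k
  have hbound : ∀ l : List V, l.Nodup → (∀ v ∈ l, v ∈ s) → l.length ≤ s.card := fun l hl hls => by
    rw [← List.toFinset_card_of_nodup hl]
    exact Finset.card_le_card fun v hv => hls v (List.mem_toFinset.1 hv)
  classical
  obtain ⟨l, hnd, hch, hls, hlen⟩ : P (Nat.findGreatest P s.card) :=
    Nat.findGreatest_spec (m := 0) (Nat.zero_le _) ⟨[], by simp⟩
  have hmax : ∀ l' : List V, l'.Nodup → l'.IsChain G.Adj → (∀ v ∈ l', v ∈ s) →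
      l'.length ≤ l.length := fun l' h1 h2 h3 => by
    rw [hlen]
    exact Nat.le_findGreatest (hbound l' h1 h3) ⟨l', h1, h2, h3, rfl⟩
  have hclosed : ∀ v ∈ l, ∀ w ∈ s, G.Adj v w → w ∈ l := by
    intro v hv w hw hvw
    by_contra hwl
    obtain ⟨l₁, l₂, rfl⟩ := List.append_of_mem hv
    rcases l₁.eq_nil_or_concat with rfl | ⟨l₁, a, rfl⟩
    · have := hmax (w :: v :: l₂) (List.nodup_cons.2 ⟨hwl, hnd⟩)
        (List.isChain_cons_cons.2 ⟨hvw.symm, hch⟩)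
        (by simpa [hw] using hls)
      simp at this
    rcases l₂ with _ | ⟨b, l₂⟩
    · have := hmax ((l₁.concat a ++ [v]) ++ [w])
        (by simp only [List.nodup_append, hnd, true_and]; grind)
        (by simp only [List.isChain_append, hch, true_and]; simp [hvw])
        (by grind)
      simp at this
    have hav : G.Adj v a := by
      simp [List.isChain_append] at hch
      grind [G.adj_comm]
    have hbv : G.Adj v b := by
      simp [List.isChain_append] at hch
      grind
    have := hdeg v (hls v (by simp)) a (hls a (by simp)) b (hls b (by simp)) w hw hav hbv hvw
    grind
  refine ⟨l, hnd, hch, Finset.Subset.antisymm (fun v hv => hls v (List.mem_toFinset.1 hv)) ?_⟩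
  intro x hx
  rw [List.mem_toFinset]
  obtain ⟨y, hy⟩ : ∃ y, y ∈ l := by
    apply List.exists_mem_of_length_pos
    exact hmax [x] (by simp) (by simp) (by simpa using hx)
  obtain ⟨p⟩ := hs ⟨y, hls y hy⟩ ⟨x, hx⟩
  have walk_mem : ∀ (u w : (s : Set V)), (G.induce (s : Set V)).Walk u w → u.1 ∈ l → w.1 ∈ l := by
    intro u w p
    induction p with
    | nil => exact id
    | cons h _ ih => exact fun hu => ih (hclosed _ hu _ (Subtype.prop _) h)
  exact walk_mem _ _ p hy

/-- On a connected position of maximum degree at most two, the Grundy value of the 0.33 game is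
the number of vertices modulo three. -/
theorem grundy_eq_card_mod_three {V : Type} [DecidableEq V] {G : SimpleGraph V} (s : Finset V)
    (hdeg : ∀ v ∈ s, ∀ a ∈ s, ∀ b ∈ s, ∀ c ∈ s, G.Adj v a → G.Adj v b → G.Adj v c →
      a = b ∨ a = c ∨ b = c)
    (hs : (G.induce (s : Set V)).Preconnected) : grundy G s = s.card % 3 := by
  induction hk : s.card using Nat.strong_induction_on generalizing s with
  | _ k ih =>
  have hval : ∀ t, ValidMove G s t → grundy G t = t.card % 3 := fun t ht => by
    have hsub := ht.1
    refine ih _ (hk ▸ ht.card_lt) t ?_ ((validMove_iff_of_preconnected hs).1 ht).2.2 rfl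
    exact fun v hv a ha b hb c hc => hdeg v (hsub hv) a (hsub ha) b (hsub hb) c (hsub hc)
  obtain ⟨l, hnd, hch, rfl⟩ := exists_isChain_toFinset_eq hdeg hs
  rw [List.toFinset_card_of_nodup hnd] at hk
  have hpre : ∀ l' : List V, l'.IsChain G.Adj →
      (G.induce (l'.toFinset : Set V)).Preconnected := fun l' h => by
    rw [List.coe_toFinset]
    exact induce_preconnected_of_isChain l' h
  rw [grundy]
  apply mex_eq
  · rintro ⟨⟨t, ht⟩, h⟩
    rw [hval t ht] at h
    have hc := Finset.card_sdiff_add_card_eq_card ht.1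
    rw [List.toFinset_card_of_nodup hnd, hk] at hc
    rcases ht.2.1 with ⟨x, -, hx⟩ | ⟨x, -, y, -, hxy, hx⟩
    · rw [hx, Finset.card_singleton] at hc
      omega
    · rw [hx, Finset.card_pair hxy.ne] at hc
      omega
  · have hone : 1 ≤ k → ∃ t, ValidMove G l.toFinset t ∧ t.card = k - 1 := by
      intro h
      obtain ⟨x, l, rfl⟩ := List.exists_cons_of_length_pos (hk ▸ h : 0 < l.length)
      rw [List.nodup_cons] at hnd
      refine ⟨l.toFinset, (validMove_iff_of_preconnected hs).2
        ⟨by simp, Or.inl ⟨x, by simp, ?_⟩, hpre l hch.tail⟩, ?_⟩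
      · ext v
        simp only [Finset.mem_sdiff, List.mem_toFinset, List.mem_cons, Finset.mem_singleton]
        grind
      · rw [List.toFinset_card_of_nodup hnd.2, ← hk]
        simp
    have htwo : 2 ≤ k → ∃ t, ValidMove G l.toFinset t ∧ t.card = k - 2 := by
      intro h
      obtain ⟨x, l, rfl⟩ := List.exists_cons_of_length_pos (by omega : 0 < l.length)
      obtain ⟨y, l, rfl⟩ := List.exists_cons_of_length_pos
        (by simp only [List.length_cons] at hk; omega : 0 < l.length)
      rw [List.nodup_cons, List.nodup_cons] at hnd
      have hxy := (List.isChain_cons_cons.1 hch).1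
      refine ⟨l.toFinset, (validMove_iff_of_preconnected hs).2
        ⟨?_, Or.inr ⟨x, by simp, y, by simp, hxy, ?_⟩, hpre l hch.tail.tail⟩, ?_⟩
      · intro v
        simp only [List.mem_toFinset, List.mem_cons]
        grind
      · ext v
        simp only [Finset.mem_sdiff, List.mem_toFinset, List.mem_cons, Finset.mem_singleton,
          Finset.mem_insert]
        grind
      · rw [List.toFinset_card_of_nodup hnd.2.2, ← hk]
        simp
    intro m hm
    rcases (by omega : (1 ≤ k ∧ m = (k - 1) % 3) ∨ (2 ≤ k ∧ m = (k - 2) % 3)) with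
      ⟨h, rfl⟩ | ⟨h, rfl⟩
    · obtain ⟨t, ht, hc⟩ := hone h
      exact ⟨⟨t, ht⟩, hc ▸ hval t ht⟩
    · obtain ⟨t, ht, hc⟩ := htwo h
      exact ⟨⟨t, ht⟩, hc ▸ hval t ht⟩

theorem cycleG_adj_cases {n u v : ℕ} (hu : u < n) (hv : v < n) (h : (cycleG n).Adj u v) :
    v = u + 1 ∨ u = v + 1 ∨ (u + 1 = n ∧ v = 0) ∨ (v + 1 = n ∧ u = 0) := by
  have aux : ∀ a b : ℕ, a < n → b < n → b % n = (a + 1) % n → b = a + 1 ∨ (a + 1 = n ∧ b = 0) := by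
    intro a b ha hb h
    rw [Nat.mod_eq_of_lt hb] at h
    rcases (Nat.succ_le_of_lt ha).lt_or_eq with h' | h'
    · exact Or.inl (by rwa [Nat.mod_eq_of_lt h'] at h)
    · exact Or.inr ⟨h', by simpa [show a + 1 = n from h'] using h⟩
  rcases ((SimpleGraph.fromRel_adj _ _ _).1 h).2 with h | h
  · have := aux u v hu hv h
    omega
  · have := aux v u hv hu h
    omega

theorem cycleG_induce_range_preconnected (n : ℕ) :
    ((cycleG n).induce (Finset.range n : Set ℕ)).Preconnected := by
  have h := induce_preconnected_of_isChain (G := cycleG n) (List.range n) (by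
    rw [List.isChain_iff_getElem]
    intro i hi
    simp [cycleG])
  rwa [show {v | v ∈ List.range n} = (Finset.range n : Set ℕ) by ext; simp] at h

/-- For `n ≥ 3`, the Grundy value of the 0.33 game on the cycle `C_n` is `n mod 3`. -/
theorem grundy_cycle (n : ℕ) (hn : 3 ≤ n) :
    grundy (cycleG n) (Finset.range n) = n % 3 := by
  rw [grundy_eq_card_mod_three _ ?_ (cycleG_induce_range_preconnected n), Finset.card_range]
  intro v hv a ha b hb c hc hva hvb hvc
  rw [Finset.mem_range] at hv ha hb hc
  have h1 := cycleG_adj_cases hv ha hva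
  have h2 := cycleG_adj_cases hv hb hvb
  have h3 := cycleG_adj_cases hv hc hvc
  omega
end

section
/- For every natural number ℓ ≥ 0, the Grundy value of the 0.33 game on the subdivided star S_{1,1,ℓ} equals ℓ mod 3 (for ℓ = 0 the star S_{1,1,ℓ} is understood to be S_{1,1}, i.e. the path P_3, and the total number of vertices of S_{1,1,ℓ} is ℓ + 3, so this value also equals |V(S_{1,1,ℓ})| mod 3). -/
open SimpleGraph

theorem mex_eq_of_forall {A : Set ℕ} {k : ℕ} (hk : k ∉ A) (h : ∀ j < k, j ∈ A) : mex A = k := by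
  refine le_antisymm (Nat.sInf_le hk) (le_csInf ⟨k, hk⟩ fun b hb => ?_)
  by_contra! hlt
  exact hb (h b hlt)

section Connectivity

theorem compOf_eq_of_connected {V : Type} {G : SimpleGraph V} {s : Set V} (hs : (G.induce s).Connected) {x : V} (hx : x ∈ s) :
    compOf G s x = s := by
  ext v
  exact ⟨fun ⟨_, hv, _⟩ => hv, fun hv => ⟨hx, hv, hs.preconnected _ _⟩⟩

variable {V : Type} [DecidableEq V] {G : SimpleGraph V} {s t : Finset V}

theorem compOf_sdiff_coe_sdiff (hs : (G.induce (↑s : Set V)).Connected) (hts : t ⊆ s) {x : V}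
    (hx : x ∈ s) : compOf G (↑s) x \ ↑(s \ t) = ↑t := by
  rw [compOf_eq_of_connected hs hx, ← Finset.coe_sdiff, Finset.sdiff_sdiff_eq_self hts]

/-- A valid move on a connected position leads to the empty position or to a connected one. -/
theorem ValidMove.eq_empty_or_connected (hs : (G.induce (↑s : Set V)).Connected)
    (h : ValidMove G s t) : t = ∅ ∨ (G.induce (↑t : Set V)).Connected := by
  obtain ⟨hts, hrem, hcomp⟩ := h
  obtain ⟨x, hx⟩ : (s \ t).Nonempty := by
    rcases hrem with ⟨x, _, he⟩ | ⟨x, _, y, _, _, he⟩ <;> simp [he]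
  have h := hcomp x hx
  rwa [compOf_sdiff_coe_sdiff hs hts (Finset.mem_sdiff.mp hx).1, Finset.coe_eq_empty] at h

theorem ValidMove.card_eq (h : ValidMove G s t) :
    s.card = t.card + 1 ∨ s.card = t.card + 2 := by
  have hcard := Finset.card_sdiff_add_card_eq_card h.1
  rcases h.2.1 with ⟨x, _, he⟩ | ⟨x, _, y, _, hxy, he⟩
  · rw [he, Finset.card_singleton] at hcard
    omega
  · rw [he, Finset.card_pair hxy.ne] at hcard
    omega

theorem validMove_of_connected (hs : (G.induce (↑s : Set V)).Connected) (hts : t ⊆ s)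
    (hrem : (∃ x ∈ s, s \ t = {x}) ∨ (∃ x ∈ s, ∃ y ∈ s, G.Adj x y ∧ s \ t = {x, y}))
    (ht : t = ∅ ∨ (G.induce (↑t : Set V)).Connected) : ValidMove G s t := by
  refine ⟨hts, hrem, fun x hx => ?_⟩
  rwa [compOf_sdiff_coe_sdiff hs hts (Finset.mem_sdiff.mp hx).1, Finset.coe_eq_empty]

theorem connected_induce_erase_of_compl_singleton {v : V} (hv : v ∈ s)
    (h : ((G.induce (↑s : Set V)).induce {(⟨v, hv⟩ : (↑s : Set V))}ᶜ).Connected) :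
    (G.induce (↑(s.erase v) : Set V)).Connected := by
  let f : (G.induce (↑s : Set V)).induce {(⟨v, hv⟩ : (↑s : Set V))}ᶜ →g
      G.induce (↑(s.erase v) : Set V) :=
    ⟨fun x => ⟨x.1.1, by
      have hx := x.2
      have hxs := x.1.2
      simp only [Set.mem_compl_iff, Set.mem_singleton_iff, Subtype.ext_iff] at hx
      exact Finset.mem_coe.mpr (Finset.mem_erase.mpr ⟨hx, hxs⟩)⟩, fun hab => hab⟩
  refine h.map f fun y => ?_
  have hy := Finset.mem_erase.mp (Finset.mem_coe.mp y.2)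
  exact ⟨⟨⟨y.1, hy.2⟩, by simpa [Subtype.ext_iff] using hy.1⟩, rfl⟩

theorem exists_connected_induce_erase (hs : (G.induce (↑s : Set V)).Connected)
    (hcard : 2 ≤ s.card) : ∃ v ∈ s, (G.induce (↑(s.erase v) : Set V)).Connected := by
  have : Nontrivial (↑s : Set V) :=
    (Finset.one_lt_card_iff_nontrivial.mp hcard).coe_sort
  obtain ⟨v, hv⟩ := hs.exists_connected_induce_compl_singleton_of_finite_nontrivial
  exact ⟨v.1, v.2, connected_induce_erase_of_compl_singleton v.2 hv⟩

theorem connected_induce_erase_of_forall_adj_eq (hs : (G.induce (↑s : Set V)).Connected)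
    (hcard : 2 ≤ s.card) {v w : V} (hv : v ∈ s) (hw : ∀ u ∈ s, G.Adj v u → u = w) :
    w ∈ s ∧ G.Adj v w ∧ (G.induce (↑(s.erase v) : Set V)).Connected := by
  have : Nontrivial (↑s : Set V) :=
    (Finset.one_lt_card_iff_nontrivial.mp hcard).coe_sort
  obtain ⟨⟨u, hu⟩, hvu⟩ := hs.preconnected.exists_adj_of_nontrivial ⟨v, hv⟩
  obtain rfl := hw u hu hvu
  classical
  refine ⟨hu, hvu, connected_induce_erase_of_compl_singleton hv
    (hs.induce_compl_singleton_of_degree_eq_one ?_)⟩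
  rw [degree_eq_one_iff_existsUnique_adj]
  exact ⟨⟨u, hu⟩, hvu, fun y hy => Subtype.ext (hw y.1 y.2 hy)⟩

theorem exists_validMove_card_add_one (hs : (G.induce (↑s : Set V)).Connected) :
    ∃ t, ValidMove G s t ∧ s.card = t.card + 1 := by
  have hpos : 0 < s.card := by
    obtain ⟨x⟩ := hs.nonempty
    exact Finset.card_pos.mpr ⟨x.1, x.2⟩
  rcases (show s.card = 1 ∨ 2 ≤ s.card by omega) with h1 | h2
  · obtain ⟨x, rfl⟩ := Finset.card_eq_one.mp h1
    exact ⟨∅, validMove_of_connected hs (by simp) (.inl ⟨x, by simp⟩) (.inl rfl), by simp⟩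
  · obtain ⟨v, hv, hc⟩ := exists_connected_induce_erase hs h2
    refine ⟨s.erase v, validMove_of_connected hs (Finset.erase_subset _ _)
      (.inl ⟨v, hv, ?_⟩) (.inr hc), (Finset.card_erase_add_one hv).symm⟩
    rw [Finset.sdiff_erase hv, Finset.sdiff_self, insert_empty_eq]

theorem exists_validMove_card_add_two_of_adj (hs : (G.induce (↑s : Set V)).Connected)
    {x y : V} (hx : x ∈ s) (hy : y ∈ s) (hxy : G.Adj x y)
    (h : (s.erase x).erase y = ∅ ∨ (G.induce (↑((s.erase x).erase y) : Set V)).Connected) :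
    ∃ t, ValidMove G s t ∧ s.card = t.card + 2 := by
  have hy' : y ∈ s.erase x := Finset.mem_erase.mpr ⟨hxy.ne', hy⟩
  refine ⟨(s.erase x).erase y, validMove_of_connected hs
    ((Finset.erase_subset _ _).trans (Finset.erase_subset _ _))
    (.inr ⟨x, hx, y, hy, hxy, ?_⟩) h, ?_⟩
  · ext z
    by_cases hzx : z = x <;> by_cases hzy : z = y <;> simp_all
  · have h1 := Finset.card_erase_add_one hx
    have h2 := Finset.card_erase_add_one hy'
    omega

/-- If from every connected position contained in `s₀` with at least five vertices some two
adjacent vertices can be removed, then the Grundy value on such positions is the number of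
vertices modulo three. -/
theorem grundy_eq_card_mod_three_s3 {s₀ : Finset V}
    (hpair : ∀ s ⊆ s₀, (G.induce (↑s : Set V)).Connected → 5 ≤ s.card →
      ∃ t, ValidMove G s t ∧ s.card = t.card + 2)
    (s : Finset V) (hs₀ : s ⊆ s₀) (hs : s = ∅ ∨ (G.induce (↑s : Set V)).Connected) :
    grundy G s = s.card % 3 := by
  induction hn : s.card using Nat.strong_induction_on generalizing s with
  | _ n ih =>
  subst hn
  rw [grundy]
  rcases hs with rfl | hs
  · refine mex_eq_of_forall ?_ (by simp)
    rintro ⟨⟨t, ht⟩, _⟩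
    simpa using ht.card_lt
  have hg : ∀ t, ValidMove G s t → grundy G t = t.card % 3 := fun t ht =>
    ih _ ht.card_lt t (ht.1.trans hs₀) (ht.eq_empty_or_connected hs) rfl
  obtain ⟨t₁, ht₁, hc₁⟩ := exists_validMove_card_add_one hs
  apply mex_eq_of_forall
  · rintro ⟨⟨t, ht⟩, he⟩
    rw [hg t ht] at he
    rcases ht.card_eq with h | h <;> omega
  · intro j hj
    rcases (show j + 1 = s.card % 3 ∨ (j = 0 ∧ s.card % 3 = 2) by omega) with h | ⟨rfl, h⟩
    · exact ⟨⟨t₁, ht₁⟩, by rw [hg t₁ ht₁]; omega⟩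
    · obtain ⟨t₂, ht₂, hc₂⟩ : ∃ t, ValidMove G s t ∧ s.card = t.card + 2 := by
        rcases (show s.card = 2 ∨ 5 ≤ s.card by omega) with h2 | h5
        · obtain ⟨x, y, hxy, rfl⟩ := Finset.card_eq_two.mp h2
          obtain ⟨_, hadj, _⟩ := connected_induce_erase_of_forall_adj_eq hs h2.ge
            (v := x) (w := y) (by simp) (by
              intro u hu hxu
              rcases Finset.mem_insert.mp hu with rfl | hu
              · exact absurd rfl hxu.ne
              · exact Finset.mem_singleton.mp hu)
          exact exists_validMove_card_add_two_of_adj hs (by simp) (by simp) hadj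
            (.inl (by ext z; simp; tauto))
        · exact hpair s hs₀ hs h5
      exact ⟨⟨t₂, ht₂⟩, by rw [hg t₂ ht₂]; omega⟩

end Connectivity

theorem mem_bistarVerts_one_one {ℓ : ℕ} {v : ℕ × ℕ} :
    v ∈ bistarVerts (some [1, 1, ℓ]) (some []) 0 ↔
      v = (0, 0) ∨ v = (2, 1) ∨ v = (4, 1) ∨ (v.1 = 6 ∧ 1 ≤ v.2 ∧ v.2 ≤ ℓ) := by
  obtain ⟨a, b⟩ := v
  simp only [bistarVerts, armVerts, Finset.mem_union, Finset.mem_insert, Finset.mem_biUnion,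
    Finset.mem_image, Finset.mem_range, List.length_cons, List.length_nil, Prod.mk.injEq]
  constructor
  · rintro ((h | ⟨i, hi, j, hj, h⟩) | ⟨j, hj, h⟩ | ⟨i, hi, h⟩)
    · omega
    · interval_cases i <;> simp at hj h <;> omega
    · omega
    · omega
  · rintro (h | h | h | h)
    · exact .inl (.inl h)
    · exact .inl (.inr ⟨0, by simp, 0, by simp, by omega, by omega⟩)
    · exact .inl (.inr ⟨1, by simp, 0, by simp, by omega, by omega⟩)
    · exact .inl (.inr ⟨2, by simp, b - 1, by simp; omega, by omega, by omega⟩)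

theorem card_bistarVerts_one_one (ℓ : ℕ) :
    (bistarVerts (some [1, 1, ℓ]) (some []) 0).card = ℓ + 3 := by
  have h : bistarVerts (some [1, 1, ℓ]) (some []) 0 =
      {(0, 0), (2, 1), (4, 1)} ∪ {6} ×ˢ Finset.Icc 1 ℓ := by
    ext v
    simp only [mem_bistarVerts_one_one, Finset.mem_union, Finset.mem_insert,
      Finset.mem_singleton, Finset.mem_product, Finset.mem_Icc, or_assoc]
  rw [h, Finset.card_union_of_disjoint, Finset.card_product]
  · simp [add_comm]
  · simp [Finset.disjoint_left]

theorem connected_bistarVerts_one_one (ℓ : ℕ) :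
    ((bistarG 0).induce
      (↑(bistarVerts (some [1, 1, ℓ]) (some []) 0) : Set (ℕ × ℕ))).Connected := by
  have hc : ((0, 0) : ℕ × ℕ) ∈ (↑(bistarVerts (some [1, 1, ℓ]) (some []) 0) : Set (ℕ × ℕ)) :=
    mem_bistarVerts_one_one.mpr (.inl rfl)
  have harm : ∀ n (hn : ((6, n + 1) : ℕ × ℕ) ∈
      (↑(bistarVerts (some [1, 1, ℓ]) (some []) 0) : Set (ℕ × ℕ))),
      ((bistarG 0).induce _).Reachable ⟨(0, 0), hc⟩ ⟨(6, n + 1), hn⟩ := by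
    intro n
    induction n with
    | zero =>
      intro hn
      exact Adj.reachable (by simp [bistarG])
    | succ n ih =>
      intro hn
      have hn' := mem_bistarVerts_one_one.mp hn
      simp only [Prod.mk.injEq] at hn'
      refine (ih (mem_bistarVerts_one_one.mpr (by simp; omega))).trans
        (Adj.reachable (by simp [bistarG]))
  rw [connected_iff_exists_forall_reachable]
  refine ⟨⟨(0, 0), hc⟩, ?_⟩
  rintro ⟨⟨a, b⟩, hv⟩
  rcases mem_bistarVerts_one_one.mp hv with h | h | h | ⟨rfl, h, -⟩
  · obtain ⟨rfl, rfl⟩ := Prod.mk.inj h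
    rfl
  · obtain ⟨rfl, rfl⟩ := Prod.mk.inj h
    exact Adj.reachable (by simp [bistarG])
  · obtain ⟨rfl, rfl⟩ := Prod.mk.inj h
    exact Adj.reachable (by simp [bistarG])
  · obtain ⟨n, rfl⟩ := Nat.exists_eq_add_of_le' h
    exact harm n hv

theorem exists_arm_end_mem {ℓ : ℕ} {s : Finset (ℕ × ℕ)}
    (hs : s ⊆ bistarVerts (some [1, 1, ℓ]) (some []) 0) (hcard : 4 ≤ s.card) :
    ∃ n, 1 ≤ n ∧ (6, n) ∈ s ∧ ∀ k, (6, k) ∈ s → k ≤ n := by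
  obtain ⟨⟨a, n⟩, hmem, hmax⟩ : ∃ v ∈ s.filter (fun v : ℕ × ℕ => v.1 = 6),
      ∀ u ∈ s.filter (fun v : ℕ × ℕ => v.1 = 6), u.2 ≤ v.2 := by
    apply Finset.exists_max_image
    by_contra hne
    rw [Finset.not_nonempty_iff_eq_empty, Finset.filter_eq_empty_iff] at hne
    have hsub : s ⊆ {(0, 0), (2, 1), (4, 1)} := fun v hv => by
      rcases mem_bistarVerts_one_one.mp (hs hv) with h | h | h | h
      · simp [h]
      · simp [h]
      · simp [h]
      · exact absurd h.1 (hne hv)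
    have hle := (Finset.card_le_card hsub).trans Finset.card_le_three
    omega
  obtain ⟨hv, rfl⟩ := Finset.mem_filter.mp hmem
  refine ⟨n, ?_, hv, fun k hk => hmax (6, k) (Finset.mem_filter.mpr ⟨hk, rfl⟩)⟩
  have := mem_bistarVerts_one_one.mp (hs hv)
  simp only [Prod.mk.injEq] at this
  omega

theorem eq_of_adj_arm_end {ℓ n : ℕ} {s : Finset (ℕ × ℕ)}
    (hs : s ⊆ bistarVerts (some [1, 1, ℓ]) (some []) 0)
    (hmax : ∀ k, (6, k) ∈ s → k ≤ n) (u : ℕ × ℕ) (hu : u ∈ s) (hadj : (bistarG 0).Adj (6, n) u) :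
    u = if n = 1 then (0, 0) else (6, n - 1) := by
  obtain ⟨a, b⟩ := u
  have hmem := mem_bistarVerts_one_one.mp (hs hu)
  have hle : a = 6 → b ≤ n := by
    rintro rfl
    exact hmax b hu
  simp only [bistarG, fromRel_adj, Prod.mk.injEq, if_true] at hadj hmem
  split_ifs <;> simp only [Prod.mk.injEq] <;> omega

theorem exists_validMove_card_add_two_star {ℓ : ℕ} (s : Finset (ℕ × ℕ))
    (hs : s ⊆ bistarVerts (some [1, 1, ℓ]) (some []) 0)
    (hconn : ((bistarG 0).induce (↑s : Set (ℕ × ℕ))).Connected) (hcard : 5 ≤ s.card) :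
    ∃ t, ValidMove (bistarG 0) s t ∧ s.card = t.card + 2 := by
  obtain ⟨n, hn, hmem, hmax⟩ := exists_arm_end_mem hs (by omega)
  obtain ⟨hw, hadj, hconn'⟩ := connected_induce_erase_of_forall_adj_eq hconn (by omega) hmem
    (eq_of_adj_arm_end hs hmax)
  have hs' := (Finset.erase_subset (6, n) s).trans hs
  have hcard' := Finset.card_erase_add_one hmem
  obtain ⟨k, hk, hkmem, hkmax⟩ := exists_arm_end_mem hs' (by omega)
  have hkn : k ≠ n := fun h => (Finset.mem_erase.mp hkmem).1 (by rw [h])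
  have hkle := hmax k (Finset.mem_erase.mp hkmem).2
  rw [if_neg (by omega)] at hw hadj
  obtain rfl : k = n - 1 := by
    have := hkmax (n - 1) (Finset.mem_erase.mpr ⟨by simp; omega, hw⟩)
    omega
  exact exists_validMove_card_add_two_of_adj hconn hmem hw hadj
    (.inr (connected_induce_erase_of_forall_adj_eq hconn' (by omega) hkmem
      (eq_of_adj_arm_end hs' hkmax)).2.2)

/-- The Grundy value of the 0.33 game on `S_{1,1,ℓ}` is `ℓ mod 3`
(for `ℓ = 0` the third arm is empty and the star is `S_{1,1} = P₃`). -/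
theorem grundy_star_one_one_ell (ℓ : ℕ) : starGrundy [1, 1, ℓ] = ℓ % 3 := by
  rw [starGrundy, bistarGrundy, bistarGrundyO, grundy_eq_card_mod_three_s3
    exists_validMove_card_add_two_star _ subset_rfl (.inr (connected_bistarVerts_one_one ℓ)),
    card_bistarVerts_one_one, Nat.add_mod_right]
end

section
/- Let k ≥ 4 be an even integer and let 0 ≤ j ≤ k. Let S be the subdivided star with k arms, exactly j of which have 2 vertices and the remaining k−j of which have 1 vertex. Then the Grundy value of the 0.33 game on S is: 0 if j = 0; 3 if j = 1; 1 if j = 2; 2 if j = 3; and for j ≥ 4 it is 0 if j is even and 3 if j is odd. -/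
open SimpleGraph

section Moves

variable {V : Type} {G : SimpleGraph V}

/-- In a preconnected induced subgraph, a predicate invariant under adjacency is constant. -/
theorem iff_of_preconnected_induce {s : Set V} (hs : (G.induce s).Preconnected) {p : V → Prop}
    (hp : ∀ x ∈ s, ∀ y ∈ s, G.Adj x y → p x → p y) {x y : V} (hx : x ∈ s) (hy : y ∈ s)
    (hpx : p x) : p y := by
  obtain ⟨w⟩ := hs ⟨x, hx⟩ ⟨y, hy⟩
  suffices h : ∀ (u v : s), (G.induce s).Walk u v → p u → p v from h _ _ w hpx
  intro u v w
  induction w with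
  | nil => exact id
  | cons h _ ih => exact fun hu => ih (hp _ (Subtype.prop _) _ (Subtype.prop _) h hu)

theorem preconnected_induce_of_reachable {s : Set V} {c : V} (hc : c ∈ s)
    (h : ∀ x (hx : x ∈ s), (G.induce s).Reachable ⟨c, hc⟩ ⟨x, hx⟩) :
    (G.induce s).Preconnected :=
  fun x y => (h x x.2).symm.trans (h y y.2)

variable [DecidableEq V]

theorem validMove_iff {s t : Finset V} (hs : (G.induce (s : Set V)).Preconnected) :
    ValidMove G s t ↔
      ((∃ x ∈ s, t = s.erase x) ∨
        (∃ x ∈ s, ∃ y ∈ s, G.Adj x y ∧ t = (s.erase x).erase y)) ∧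
      (G.induce (t : Set V)).Preconnected := by
  have hcomp : ∀ x ∈ s, compOf G s x = s := by
    intro x hx
    ext v
    exact ⟨fun ⟨_, hv, _⟩ => hv, fun hv => ⟨hx, hv, hs _ _⟩⟩
  have hdiff : t ⊆ s → ∀ x ∈ s, compOf G s x \ (↑(s \ t) : Set V) = t := by
    intro hts x hx
    rw [hcomp x hx, ← Finset.coe_sdiff, Finset.sdiff_sdiff_eq_self hts]
  have hpre : ∀ r : Set V, (r = ∅ ∨ (G.induce r).Connected) ↔ (G.induce r).Preconnected := by
    intro r
    rcases r.eq_empty_or_nonempty with rfl | hr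
    · exact ⟨fun _ x => x.2.elim, fun _ => Or.inl rfl⟩
    · have := hr.to_subtype
      exact ⟨fun h => h.elim (fun h => (hr.ne_empty h).elim) (·.preconnected),
        fun h => Or.inr ⟨h⟩⟩
  constructor
  · rintro ⟨hts, hrem, hconn⟩
    have ht : t = s \ (s \ t) := (Finset.sdiff_sdiff_eq_self hts).symm
    have hex : ∃ x, x ∈ s \ t := by
      rcases hrem with ⟨x, _, h⟩ | ⟨x, _, y, _, _, h⟩ <;> exact ⟨x, by simp [h]⟩
    refine ⟨?_, ?_⟩
    · rcases hrem with ⟨x, hx, h⟩ | ⟨x, hx, y, hy, ha, h⟩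
      · refine Or.inl ⟨x, hx, ?_⟩
        rw [h] at ht
        rw [ht]
        grind
      · refine Or.inr ⟨x, hx, y, hy, ha, ?_⟩
        rw [h] at ht
        rw [ht]
        grind
    · obtain ⟨x, hx⟩ := hex
      have h := hconn x hx
      rwa [hdiff hts x (Finset.mem_sdiff.mp hx).1, hpre] at h
  · rintro ⟨hrem, hconn⟩
    have hts : t ⊆ s := by
      rcases hrem with ⟨x, _, rfl⟩ | ⟨x, _, y, _, _, rfl⟩ <;> grind
    refine ⟨hts, ?_, fun x hx => ?_⟩
    · rcases hrem with ⟨x, hx, rfl⟩ | ⟨x, hx, y, hy, ha, rfl⟩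
      · exact Or.inl ⟨x, hx, by grind⟩
      · exact Or.inr ⟨x, hx, y, hy, ha, by grind⟩
    · rwa [hdiff hts x (Finset.mem_sdiff.mp hx).1, hpre]

theorem grundy_eq {s : Finset V} {n : ℕ} (hne : ∀ t, ValidMove G s t → grundy G t ≠ n)
    (hlt : ∀ m < n, ∃ t, ValidMove G s t ∧ grundy G t = m) : grundy G s = n := by
  rw [grundy]
  refine mex_eq ?_ fun m hm => ?_
  · rintro ⟨⟨t, ht⟩, h⟩
    exact hne t ht h
  · obtain ⟨t, ht, h⟩ := hlt m hm
    exact ⟨⟨t, ht⟩, h⟩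

end Moves

section Paths

variable {V : Type} {G : SimpleGraph V}

/-- `f` enumerates the vertices of an induced path of `G` along the interval `[a, b)`. -/
def IsInducedPath (G : SimpleGraph V) (f : ℕ → V) (a b : ℕ) : Prop :=
  Set.InjOn f (Set.Ico a b) ∧
    ∀ i ∈ Set.Ico a b, ∀ j ∈ Set.Ico a b, G.Adj (f i) (f j) ↔ j = i + 1 ∨ i = j + 1

theorem IsInducedPath.mono {f : ℕ → V} {a b a' b' : ℕ} (h : IsInducedPath G f a b)
    (ha : a ≤ a') (hb : b' ≤ b) : IsInducedPath G f a' b' :=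
  have hs : Set.Ico a' b' ⊆ Set.Ico a b := Set.Ico_subset_Ico ha hb
  ⟨h.1.mono hs, fun i hi j hj => h.2 i (hs hi) j (hs hj)⟩

variable [DecidableEq V]

theorem IsInducedPath.preconnected {f : ℕ → V} {a b : ℕ} (h : IsInducedPath G f a b) :
    (G.induce (((Finset.Ico a b).image f : Finset V) : Set V)).Preconnected := by
  rcases le_or_gt b a with hab | hab
  · intro x
    have := x.2
    simp [Finset.Ico_eq_empty_of_le hab] at this
  have hmem : ∀ i, a ≤ i → i < b → f i ∈ (((Finset.Ico a b).image f : Finset V) : Set V) := by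
    intro i h1 h2
    exact Finset.mem_coe.mpr (Finset.mem_image_of_mem f (Finset.mem_Ico.mpr ⟨h1, h2⟩))
  have hreach : ∀ i (h1 : a ≤ i) (h2 : i < b),
      (G.induce (((Finset.Ico a b).image f : Finset V) : Set V)).Reachable
        ⟨f a, hmem a le_rfl hab⟩ ⟨f i, hmem i h1 h2⟩ := by
    intro i h1
    induction i, h1 using Nat.le_induction with
    | base => exact fun _ => Reachable.refl _
    | succ i h1 ih =>
      intro h2
      refine (ih (by omega)).trans (Adj.reachable ?_)
      exact (h.2 i ⟨h1, by omega⟩ (i + 1) ⟨by omega, h2⟩).2 (Or.inl rfl)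
  refine preconnected_induce_of_reachable (hmem a le_rfl hab) fun x hx => ?_
  obtain ⟨i, hi, rfl⟩ := Finset.mem_image.mp (Finset.mem_coe.mp hx)
  rw [Finset.mem_Ico] at hi
  exact hreach i hi.1 hi.2

/-- Deleting a nonempty inner segment of an induced path disconnects it. -/
theorem IsInducedPath.eq_or_eq_of_preconnected {f : ℕ → V} {a b i j : ℕ}
    (h : IsInducedPath G f a b) (hai : a ≤ i) (hij : i < j) (hjb : j ≤ b)
    (hc : (G.induce (((Finset.Ico a i ∪ Finset.Ico j b).image f : Finset V) : Set V)).Preconnected) :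
    i = a ∨ j = b := by
  by_contra! hne
  have hmem : ∀ n, n ∈ Finset.Ico a i ∪ Finset.Ico j b →
      f n ∈ (((Finset.Ico a i ∪ Finset.Ico j b).image f : Finset V) : Set V) :=
    fun n hn => Finset.mem_coe.mpr (Finset.mem_image_of_mem f hn)
  have key := iff_of_preconnected_induce hc (p := fun v => ∃ n, a ≤ n ∧ n < i ∧ f n = v) ?_
    (hmem a (by simp; omega)) (hmem j (by simp; omega)) ⟨a, le_rfl, by omega, rfl⟩
  · obtain ⟨n, h1, h2, h3⟩ := key
    have := h.1 ⟨h1, by omega⟩ ⟨by omega, by omega⟩ h3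
    omega
  · rintro x - y hy hxy ⟨n, h1, h2, rfl⟩
    obtain ⟨m, hm, rfl⟩ := Finset.mem_image.mp (Finset.mem_coe.mp hy)
    simp only [Finset.mem_union, Finset.mem_Ico] at hm
    have := (h.2 n ⟨h1, by omega⟩ m ⟨by omega, by omega⟩).1 hxy
    exact ⟨m, by omega, by omega, rfl⟩

theorem image_Ico_erase {f : ℕ → V} {a b i : ℕ} (h : Set.InjOn f (Set.Ico a b))
    (hi : i ∈ Finset.Ico a b) :
    ((Finset.Ico a b).image f).erase (f i) =
      (Finset.Ico a i ∪ Finset.Ico (i + 1) b).image f := by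
  rw [Finset.mem_Ico] at hi
  ext v
  simp only [Finset.mem_erase, Finset.mem_image, Finset.mem_union, Finset.mem_Ico]
  constructor
  · rintro ⟨hne, n, hn, rfl⟩
    have : n ≠ i := fun h => hne (h ▸ rfl)
    exact ⟨n, by omega, rfl⟩
  · rintro ⟨n, hn, rfl⟩
    refine ⟨fun he => ?_, n, by omega, rfl⟩
    have := h ⟨by omega, by omega⟩ hi he
    omega

theorem image_Ico_erase_erase {f : ℕ → V} {a b i : ℕ} (h : Set.InjOn f (Set.Ico a b))
    (hi : i ∈ Finset.Ico a b) (hi' : i + 1 ∈ Finset.Ico a b) :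
    (((Finset.Ico a b).image f).erase (f i)).erase (f (i + 1)) =
      (Finset.Ico a i ∪ Finset.Ico (i + 2) b).image f := by
  rw [image_Ico_erase h hi]
  rw [Finset.mem_Ico] at hi hi'
  ext v
  simp only [Finset.mem_erase, Finset.mem_image, Finset.mem_union, Finset.mem_Ico]
  constructor
  · rintro ⟨hne, n, hn, rfl⟩
    have : n ≠ i + 1 := fun h => hne (h ▸ rfl)
    exact ⟨n, by omega, rfl⟩
  · rintro ⟨n, hn, rfl⟩
    refine ⟨fun he => ?_, n, by omega, rfl⟩
    have := h ⟨by omega, by omega⟩ hi' he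
    omega

theorem IsInducedPath.exists_of_validMove {f : ℕ → V} {a b : ℕ} (h : IsInducedPath G f a b)
    {t : Finset V} (ht : ValidMove G ((Finset.Ico a b).image f) t) :
    ∃ a' b', a ≤ a' ∧ b' ≤ b ∧ a' ≤ b' ∧
      (b' - a' + 1 = b - a ∨ b' - a' + 2 = b - a) ∧ t = (Finset.Ico a' b').image f := by
  have ht' := (validMove_iff h.preconnected).1 ht
  have hseg : ∃ i j, a ≤ i ∧ j ≤ b ∧ (j = i + 1 ∨ j = i + 2) ∧
      t = (Finset.Ico a i ∪ Finset.Ico j b).image f := by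
    rcases ht'.1 with ⟨x, hx, rfl⟩ | ⟨x, hx, y, hy, hxy, rfl⟩
    · obtain ⟨i, hi, rfl⟩ := Finset.mem_image.mp hx
      have hi' := Finset.mem_Ico.mp hi
      exact ⟨i, i + 1, hi'.1, by omega, Or.inl rfl, image_Ico_erase h.1 hi⟩
    · obtain ⟨i, hi, rfl⟩ := Finset.mem_image.mp hx
      obtain ⟨j, hj, rfl⟩ := Finset.mem_image.mp hy
      have hi' := Finset.mem_Ico.mp hi
      have hj' := Finset.mem_Ico.mp hj
      rcases (h.2 i hi' j hj').1 hxy with rfl | rfl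
      · exact ⟨i, i + 2, hi'.1, by omega, Or.inr rfl, image_Ico_erase_erase h.1 hi hj⟩
      · refine ⟨j, j + 2, hj'.1, by omega, Or.inr rfl, ?_⟩
        rw [Finset.erase_right_comm]
        exact image_Ico_erase_erase h.1 hj hi
  obtain ⟨i, j, hai, hjb, hij, rfl⟩ := hseg
  rcases h.eq_or_eq_of_preconnected hai (by omega) hjb ht'.2 with rfl | rfl
  · exact ⟨j, b, by omega, le_rfl, by omega, by omega, by simp⟩
  · exact ⟨a, i, le_rfl, by omega, hai, by omega, by simp⟩

theorem IsInducedPath.validMove_one {f : ℕ → V} {a b : ℕ} (h : IsInducedPath G f a b)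
    (hab : a < b) :
    ValidMove G ((Finset.Ico a b).image f) ((Finset.Ico (a + 1) b).image f) := by
  have ha : a ∈ Finset.Ico a b := by simpa
  refine (validMove_iff h.preconnected).2
    ⟨Or.inl ⟨f a, Finset.mem_image_of_mem f ha, ?_⟩, (h.mono (by omega) le_rfl).preconnected⟩
  rw [image_Ico_erase h.1 ha]
  simp

theorem IsInducedPath.validMove_two {f : ℕ → V} {a b : ℕ} (h : IsInducedPath G f a b)
    (hab : a + 1 < b) :
    ValidMove G ((Finset.Ico a b).image f) ((Finset.Ico (a + 2) b).image f) := by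
  have ha : a ∈ Finset.Ico a b := by simp; omega
  have ha' : a + 1 ∈ Finset.Ico a b := by simp; omega
  refine (validMove_iff h.preconnected).2
    ⟨Or.inr ⟨f a, Finset.mem_image_of_mem f ha, f (a + 1), Finset.mem_image_of_mem f ha', ?_, ?_⟩,
      (h.mono (by omega) le_rfl).preconnected⟩
  · exact (h.2 a (Finset.mem_Ico.mp ha) _ (Finset.mem_Ico.mp ha')).2 (Or.inl rfl)
  · rw [image_Ico_erase_erase h.1 ha ha']
    simp

/-- The Grundy value of a path is its number of vertices modulo `3`. -/
theorem IsInducedPath.grundy_eq_mod {f : ℕ → V} {a b : ℕ} (h : IsInducedPath G f a b) :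
    grundy G ((Finset.Ico a b).image f) = (b - a) % 3 := by
  induction hn : b - a using Nat.strong_induction_on generalizing a b with
  | _ n ih =>
    refine grundy_eq (fun t ht => ?_) fun m hm => ?_
    · obtain ⟨a', b', h1, h2, h3, h4, rfl⟩ := h.exists_of_validMove ht
      rw [ih (b' - a') (by omega) (h.mono h1 h2) rfl]
      omega
    · have : m = (n - 1) % 3 ∨ (2 ≤ n ∧ m = (n - 2) % 3) := by omega
      rcases this with rfl | ⟨h2, rfl⟩
      · refine ⟨_, h.validMove_one (by omega), ?_⟩
        exact ih (n - 1) (by omega) (h.mono (by omega) le_rfl) (by omega)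
      · refine ⟨_, h.validMove_two (by omega), ?_⟩
        exact ih (n - 2) (by omega) (h.mono (by omega) le_rfl) (by omega)

end Paths

section Stars

theorem bistarG_zero_adj_center_arm {i n : ℕ} :
    (bistarG 0).Adj (0, 0) (2 * i + 2, n) ↔ n = 1 := by
  simp [bistarG]

theorem bistarG_zero_adj_arm_arm {i j m n : ℕ} :
    (bistarG 0).Adj (2 * i + 2, m) (2 * j + 2, n) ↔ i = j ∧ (n = m + 1 ∨ m = n + 1) := by
  simp [bistarG]
  omega

/-- The subdivided star whose arms are indexed by `K`, the arms in `B` having two vertices and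
the other ones a single vertex. -/
def starVerts (K B : Finset ℕ) : Finset (ℕ × ℕ) :=
  insert (0, 0) (K.image (fun i => (2 * i + 2, 1)) ∪ B.image (fun i => (2 * i + 2, 2)))

variable {K B : Finset ℕ}

theorem mem_starVerts {x : ℕ × ℕ} :
    x ∈ starVerts K B ↔
      x = (0, 0) ∨ (∃ i ∈ K, x = (2 * i + 2, 1)) ∨ ∃ i ∈ B, x = (2 * i + 2, 2) := by
  simp [starVerts, eq_comm]

theorem center_mem_starVerts : (0, 0) ∈ starVerts K B := by simp [mem_starVerts]

theorem inner_mem_starVerts {i : ℕ} : (2 * i + 2, 1) ∈ starVerts K B ↔ i ∈ K := by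
  simp [mem_starVerts]

theorem outer_mem_starVerts {i : ℕ} : (2 * i + 2, 2) ∈ starVerts K B ↔ i ∈ B := by
  simp [mem_starVerts]

theorem starVerts_erase_inner (i : ℕ) :
    (starVerts K B).erase (2 * i + 2, 1) = starVerts (K.erase i) B := by
  ext ⟨x, y⟩
  simp only [Finset.mem_erase, mem_starVerts, Prod.mk.injEq, ne_eq]
  grind

theorem starVerts_erase_outer (i : ℕ) :
    (starVerts K B).erase (2 * i + 2, 2) = starVerts K (B.erase i) := by
  ext ⟨x, y⟩
  simp only [Finset.mem_erase, mem_starVerts, Prod.mk.injEq, ne_eq]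
  grind

theorem starVerts_preconnected (hBK : B ⊆ K) :
    ((bistarG 0).induce (starVerts K B : Set (ℕ × ℕ))).Preconnected := by
  have hinner : ∀ i (hi : (2 * i + 2, 1) ∈ (starVerts K B : Set (ℕ × ℕ))),
      ((bistarG 0).induce (starVerts K B : Set (ℕ × ℕ))).Reachable
        ⟨(0, 0), center_mem_starVerts⟩ ⟨(2 * i + 2, 1), hi⟩ :=
    fun i _ => Adj.reachable (bistarG_zero_adj_center_arm.2 rfl)
  refine preconnected_induce_of_reachable center_mem_starVerts fun x hx => ?_
  rcases mem_starVerts.1 hx with rfl | ⟨i, hi, rfl⟩ | ⟨i, hi, rfl⟩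
  · exact Reachable.refl _
  · exact hinner i hx
  · refine (hinner i (inner_mem_starVerts.2 (hBK hi))).trans (Adj.reachable ?_)
    exact bistarG_zero_adj_arm_arm.2 ⟨rfl, Or.inl rfl⟩

theorem not_preconnected_of_inner_notMem {t : Finset (ℕ × ℕ)} {i : ℕ} (ht : t ⊆ starVerts K B)
    (hc : (0, 0) ∈ t) (hi : (2 * i + 2, 1) ∉ t) (ho : (2 * i + 2, 2) ∈ t) :
    ¬ ((bistarG 0).induce (t : Set (ℕ × ℕ))).Preconnected := by
  intro h
  have key := iff_of_preconnected_induce h (p := fun v => v = (2 * i + 2, 2)) ?_ ho hc rfl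
  · simp at key
  · rintro x - y hy hxy rfl
    rcases mem_starVerts.1 (ht hy) with rfl | ⟨j, -, rfl⟩ | ⟨j, -, rfl⟩
    · have := bistarG_zero_adj_center_arm.1 hxy.symm
      omega
    · obtain ⟨rfl, -⟩ := bistarG_zero_adj_arm_arm.1 hxy
      exact (hi hy).elim
    · have := bistarG_zero_adj_arm_arm.1 hxy
      omega

theorem not_preconnected_of_center_notMem {t : Finset (ℕ × ℕ)} {i j : ℕ}
    (ht : t ⊆ starVerts K B) (hc : (0, 0) ∉ t) (hij : i ≠ j) (hi : (2 * i + 2, 1) ∈ t)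
    (hj : (2 * j + 2, 1) ∈ t) :
    ¬ ((bistarG 0).induce (t : Set (ℕ × ℕ))).Preconnected := by
  intro h
  have hform : ∀ x ∈ t, ∃ l n, x = (2 * l + 2, n) := by
    intro x hx
    rcases mem_starVerts.1 (ht hx) with rfl | ⟨l, -, rfl⟩ | ⟨l, -, rfl⟩
    exacts [(hc hx).elim, ⟨l, 1, rfl⟩, ⟨l, 2, rfl⟩]
  have key := iff_of_preconnected_induce h (p := fun v => v.1 = 2 * i + 2) ?_ hi hj rfl
  · simp at key
    omega
  · intro x hx y hy hxy hp
    obtain ⟨l, n, rfl⟩ := hform x hx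
    obtain ⟨l', n', rfl⟩ := hform y hy
    obtain ⟨rfl, -⟩ := bistarG_zero_adj_arm_arm.1 hxy
    exact hp

theorem exists_of_validMove_starVerts (hBK : B ⊆ K) (hK : 3 ≤ K.card) {t : Finset (ℕ × ℕ)}
    (ht : ValidMove (bistarG 0) (starVerts K B) t) :
    (∃ i ∈ K, i ∉ B ∧ t = starVerts (K.erase i) B) ∨
      (∃ i ∈ B, t = starVerts K (B.erase i)) ∨
      ∃ i ∈ B, t = starVerts (K.erase i) (B.erase i) := by
  obtain ⟨hrem, hconn⟩ := (validMove_iff (starVerts_preconnected hBK)).1 ht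
  have hts := ht.1
  have hcenter : ∀ i, (0, 0) ∉ t → (∀ j ∈ K, j ≠ i → (2 * j + 2, 1) ∈ t) → False := by
    intro i hc hmem
    have hcard : 1 < (K.erase i).card := by
      have := Finset.pred_card_le_card_erase (s := K) (a := i)
      omega
    obtain ⟨a, ha, b, hb, hab⟩ := Finset.one_lt_card.1 hcard
    rw [Finset.mem_erase] at ha hb
    exact not_preconnected_of_center_notMem hts hc hab (hmem a ha.2 ha.1) (hmem b hb.2 hb.1) hconn
  rcases hrem with ⟨x, hx, rfl⟩ | ⟨x, hx, y, hy, hxy, rfl⟩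
  · rcases mem_starVerts.1 hx with rfl | ⟨i, hi, rfl⟩ | ⟨i, hi, rfl⟩
    · refine (hcenter 0 (by simp) fun j hj _ => ?_).elim
      simp [inner_mem_starVerts, hj]
    · by_cases hiB : i ∈ B
      · refine (not_preconnected_of_inner_notMem (i := i) hts ?_ ?_ ?_ hconn).elim
        · simp [center_mem_starVerts]
        · simp
        · simp [outer_mem_starVerts, hiB]
      · exact Or.inl ⟨i, hi, hiB, starVerts_erase_inner i⟩
    · exact Or.inr (Or.inl ⟨i, hi, starVerts_erase_outer i⟩)
  · have hpair : ∀ i, ((starVerts K B).erase (2 * i + 2, 1)).erase (2 * i + 2, 2) =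
        starVerts (K.erase i) (B.erase i) := by
      intro i
      rw [starVerts_erase_inner, starVerts_erase_outer]
    have hform : ∀ z ∈ starVerts K B, z = (0, 0) ∨
        ∃ i n, z = (2 * i + 2, n) ∧ (n = 1 ∨ n = 2 ∧ i ∈ B) := by
      intro z hz
      rcases mem_starVerts.1 hz with rfl | ⟨i, hi, rfl⟩ | ⟨i, hi, rfl⟩
      exacts [Or.inl rfl, Or.inr ⟨i, 1, rfl, Or.inl rfl⟩, Or.inr ⟨i, 2, rfl, Or.inr ⟨rfl, hi⟩⟩]
    rcases hform x hx with rfl | ⟨i, m, rfl, hm⟩ <;>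
      rcases hform y hy with rfl | ⟨j, n, rfl, hn⟩
    · exact (hxy.ne rfl).elim
    · refine (hcenter j (by simp) fun l hl hlj => ?_).elim
      simp [inner_mem_starVerts, hl, hlj]
    · refine (hcenter i (by simp) fun l hl hli => ?_).elim
      simp [inner_mem_starVerts, hl, hli]
    · obtain ⟨rfl, hmn⟩ := bistarG_zero_adj_arm_arm.1 hxy
      right; right
      rcases hm with rfl | ⟨rfl, hiB⟩ <;> rcases hn with rfl | ⟨rfl, hjB⟩
      · omega
      · exact ⟨i, hjB, hpair i⟩
      · rw [Finset.erase_right_comm]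
        exact ⟨i, hiB, hpair i⟩
      · omega

theorem validMove_erase_short_arm (hBK : B ⊆ K) {i : ℕ} (hi : i ∈ K) (hiB : i ∉ B) :
    ValidMove (bistarG 0) (starVerts K B) (starVerts (K.erase i) B) :=
  (validMove_iff (starVerts_preconnected hBK)).2
    ⟨Or.inl ⟨_, inner_mem_starVerts.2 hi, (starVerts_erase_inner i).symm⟩,
      starVerts_preconnected fun _ hj =>
        Finset.mem_erase.2 ⟨fun h => hiB (h ▸ hj), hBK hj⟩⟩

theorem validMove_shorten_arm (hBK : B ⊆ K) {i : ℕ} (hi : i ∈ B) :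
    ValidMove (bistarG 0) (starVerts K B) (starVerts K (B.erase i)) :=
  (validMove_iff (starVerts_preconnected hBK)).2
    ⟨Or.inl ⟨_, outer_mem_starVerts.2 hi, (starVerts_erase_outer i).symm⟩,
      starVerts_preconnected ((Finset.erase_subset _ _).trans hBK)⟩

theorem validMove_erase_long_arm (hBK : B ⊆ K) {i : ℕ} (hi : i ∈ B) :
    ValidMove (bistarG 0) (starVerts K B) (starVerts (K.erase i) (B.erase i)) :=
  (validMove_iff (starVerts_preconnected hBK)).2
    ⟨Or.inr ⟨_, inner_mem_starVerts.2 (hBK hi), _, outer_mem_starVerts.2 hi,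
      bistarG_zero_adj_arm_arm.2 ⟨rfl, Or.inl rfl⟩,
      by rw [starVerts_erase_inner, starVerts_erase_outer]⟩,
      starVerts_preconnected (Finset.erase_subset_erase i hBK)⟩

/-- The path running through the arms `i` and `j`, whose center has index `2`. -/
def throughPath (i j n : ℕ) : ℕ × ℕ :=
  if n ≤ 1 then (2 * i + 2, 2 - n) else if n = 2 then (0, 0) else (2 * j + 2, n - 2)

theorem isInducedPath_throughPath {i j : ℕ} (hij : i ≠ j) :
    IsInducedPath (bistarG 0) (throughPath i j) 0 5 := by
  refine ⟨?_, ?_⟩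
  · rintro m ⟨-, hm⟩ n ⟨-, hn⟩
    interval_cases m <;> interval_cases n <;> simp [throughPath] <;> omega
  · rintro m ⟨-, hm⟩ n ⟨-, hn⟩
    have := hij.symm
    interval_cases m <;> interval_cases n <;>
      simp [throughPath, bistarG_zero_adj_center_arm, bistarG_zero_adj_arm_arm,
        (bistarG 0).adj_comm _ (0, 0), *]

theorem grundy_starVerts_of_card_eq_two (hBK : B ⊆ K) (hK : K.card = 2) :
    grundy (bistarG 0) (starVerts K B) = B.card := by
  obtain ⟨i, j, hij, rfl⟩ := Finset.card_eq_two.1 hK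
  have hpath := isInducedPath_throughPath hij
  have hverts : starVerts {i, j} B =
      (Finset.Ico (if i ∈ B then 0 else 1) (if j ∈ B then 5 else 4)).image (throughPath i j) := by
    ext ⟨x, y⟩
    simp only [mem_starVerts, Finset.mem_image, Finset.mem_Ico, throughPath]
    constructor
    · rintro (h | ⟨l, hl, h⟩ | ⟨l, hl, h⟩)
      · exact ⟨2, by split_ifs <;> omega, by simp [h]⟩
      · rcases Finset.mem_insert.1 hl with rfl | hl
        · exact ⟨1, by split_ifs <;> omega, by simp [h]⟩
        · rw [Finset.mem_singleton] at hl
          exact ⟨3, by split_ifs <;> omega, by simp [h, hl]⟩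
      · rcases Finset.mem_insert.1 (hBK hl) with rfl | hl'
        · exact ⟨0, by rw [if_pos hl]; split_ifs <;> omega, by simp [h]⟩
        · rw [Finset.mem_singleton] at hl'
          subst hl'
          exact ⟨4, by split_ifs <;> omega, by simp [h]⟩
    · rintro ⟨n, ⟨hn, hn'⟩, h⟩
      have h5 : n < 5 := hn'.trans_le (by split_ifs <;> omega)
      interval_cases n <;> grind
  have hcard : B.card = (if i ∈ B then 1 else 0) + (if j ∈ B then 1 else 0) := by
    have : B = ({i, j} : Finset ℕ).filter (· ∈ B) := by grind
    rw [this, Finset.card_filter, Finset.sum_pair hij]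
    grind
  rw [hverts, (hpath.mono (by omega) (by split_ifs <;> omega)).grundy_eq_mod, hcard]
  split_ifs <;> rfl

/-- Grundy values of stars with `k ≥ 2` arms, `b` of which have two vertices. -/
def starValue (k b : ℕ) : ℕ :=
  if k = 2 then b
  else if k % 2 = 0 then
    if b = 0 then 0 else if b = 1 then 3 else if b = 2 then 1 else if b = 3 then 2
    else if b % 2 = 0 then 0 else 3
  else
    if b = 0 then 1 else if b = 1 then 2 else if b = 2 then 0
    else if b = 3 then if k = 3 then 1 else 3
    else if b % 2 = 0 then 1 else 2

theorem starValue_of_four_le {k b : ℕ} (hk : k ≠ 2) (hb : 4 ≤ b) :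
    starValue k b =
      if k % 2 = 0 then if b % 2 = 0 then 0 else 3 else if b % 2 = 0 then 1 else 2 := by
  unfold starValue
  grind

theorem starValue_ne_erase_short {k b : ℕ} (hk : 3 ≤ k) (hb : b < k) :
    starValue (k - 1) b ≠ starValue k b := by
  unfold starValue
  split_ifs <;> omega

theorem starValue_ne_shorten {k b : ℕ} (hk : 3 ≤ k) (hb : 0 < b) (hbk : b ≤ k) :
    starValue k (b - 1) ≠ starValue k b := by
  rcases Nat.lt_or_ge b 5 with hb5 | hb5
  · unfold starValue
    intro h
    interval_cases b <;> simp at h <;> split_ifs at h <;> omega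
  · rw [starValue_of_four_le (by omega) (by omega), starValue_of_four_le (by omega) (by omega)]
    split_ifs <;> omega

theorem starValue_ne_erase_long {k b : ℕ} (hk : 3 ≤ k) (hb : 0 < b) (hbk : b ≤ k) :
    starValue (k - 1) (b - 1) ≠ starValue k b := by
  rcases Nat.lt_or_ge b 5 with hb5 | hb5
  · unfold starValue
    intro h
    interval_cases b <;> simp at h <;> split_ifs at h <;> omega
  · rw [starValue_of_four_le (by omega) (by omega), starValue_of_four_le (by omega) (by omega)]
    split_ifs <;> omega

theorem exists_option_of_lt_starValue {k b m : ℕ} (hk : 3 ≤ k) (hbk : b ≤ k)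
    (hm : m < starValue k b) :
    (b < k ∧ m = starValue (k - 1) b) ∨ (0 < b ∧ m = starValue k (b - 1)) ∨
      (0 < b ∧ m = starValue (k - 1) (b - 1)) := by
  rcases Nat.lt_or_ge b 5 with hb | hb
  · unfold starValue at *
    interval_cases b <;> simp at hm ⊢ <;> split_ifs at hm ⊢ <;> omega
  · rw [starValue_of_four_le (by omega) (by omega)] at hm
    rw [starValue_of_four_le (by omega) (by omega), starValue_of_four_le (by omega) (by omega),
      starValue_of_four_le (by omega) (by omega)]
    split_ifs at hm ⊢ <;> omega

theorem grundy_starVerts (hBK : B ⊆ K) (hK : 2 ≤ K.card) :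
    grundy (bistarG 0) (starVerts K B) = starValue K.card B.card := by
  induction hn : K.card + B.card using Nat.strong_induction_on generalizing K B with
  | _ n ih =>
    have hle := Finset.card_le_card hBK
    rcases hK.eq_or_lt with h2 | h3
    · rw [grundy_starVerts_of_card_eq_two hBK h2.symm, starValue, if_pos h2.symm]
    have hshort : ∀ i ∈ K, i ∉ B → grundy (bistarG 0) (starVerts (K.erase i) B) =
        starValue (K.card - 1) B.card := by
      intro i hi hiB
      have hc := Finset.card_erase_of_mem hi
      rw [ih _ _ _ (by omega) rfl, hc]
      · omega
      · exact fun j hj => Finset.mem_erase.2 ⟨fun h => hiB (h ▸ hj), hBK hj⟩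
    have hshorten : ∀ i ∈ B, grundy (bistarG 0) (starVerts K (B.erase i)) =
        starValue K.card (B.card - 1) := by
      intro i hi
      have hc := Finset.card_erase_of_mem hi
      have := Finset.card_pos.2 ⟨i, hi⟩
      rw [ih _ _ ((Finset.erase_subset _ _).trans hBK) hK rfl, hc]
      omega
    have hlong : ∀ i ∈ B, grundy (bistarG 0) (starVerts (K.erase i) (B.erase i)) =
        starValue (K.card - 1) (B.card - 1) := by
      intro i hi
      have hc := Finset.card_erase_of_mem hi
      have hc' := Finset.card_erase_of_mem (hBK hi)
      rw [ih _ _ (Finset.erase_subset_erase i hBK) (by omega) rfl, hc, hc']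
      omega
    refine grundy_eq (fun t ht => ?_) fun m hm => ?_
    · rcases exists_of_validMove_starVerts hBK h3 ht with
        ⟨i, hi, hiB, rfl⟩ | ⟨i, hi, rfl⟩ | ⟨i, hi, rfl⟩
      · have hlt : B.card < K.card :=
          Finset.card_lt_card ⟨hBK, fun h => hiB (h hi)⟩
        rw [hshort i hi hiB]
        exact starValue_ne_erase_short h3 hlt
      · have := Finset.card_pos.2 ⟨i, hi⟩
        rw [hshorten i hi]
        exact starValue_ne_shorten h3 this hle
      · have := Finset.card_pos.2 ⟨i, hi⟩
        rw [hlong i hi]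
        exact starValue_ne_erase_long h3 this hle
    · rcases exists_option_of_lt_starValue h3 hle hm with
        ⟨hlt, rfl⟩ | ⟨hpos, rfl⟩ | ⟨hpos, rfl⟩
      · obtain ⟨i, hi, hiB⟩ := Finset.exists_mem_notMem_of_card_lt_card hlt
        exact ⟨_, validMove_erase_short_arm hBK hi hiB, hshort i hi hiB⟩
      · obtain ⟨i, hi⟩ := Finset.card_pos.1 hpos
        exact ⟨_, validMove_shorten_arm hBK hi, hshorten i hi⟩
      · obtain ⟨i, hi⟩ := Finset.card_pos.1 hpos
        exact ⟨_, validMove_erase_long_arm hBK hi, hlong i hi⟩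

theorem bistarVerts_replicate {k j : ℕ} (hj : j ≤ k) :
    bistarVerts (some (List.replicate j 2 ++ List.replicate (k - j) 1)) (some []) 0 =
      starVerts (Finset.range k) (Finset.range j) := by
  have hget : ∀ i < k, (List.replicate j 2 ++ List.replicate (k - j) 1).getD i 0 =
      if i < j then 2 else 1 := by
    intro i hi
    grind
  ext ⟨x, y⟩
  simp only [bistarVerts, armVerts, mem_starVerts, Finset.mem_union, Finset.mem_insert,
    Finset.mem_biUnion, Finset.mem_image, Finset.mem_range, List.length_append,
    List.length_replicate, Nat.add_sub_cancel' hj, List.length_nil, not_lt_zero, false_and,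
    exists_false, or_false]
  refine or_congr Iff.rfl ⟨?_, ?_⟩
  · rintro ⟨i, hi, n, hn, h⟩
    rw [hget i hi] at hn
    split_ifs at hn with hij
    · interval_cases n
      · exact Or.inl ⟨i, hi, h.symm⟩
      · exact Or.inr ⟨i, hij, h.symm⟩
    · interval_cases n
      exact Or.inl ⟨i, hi, h.symm⟩
  · rintro (⟨i, hi, h⟩ | ⟨i, hi, h⟩)
    · exact ⟨i, hi, 0, by rw [hget i hi]; split_ifs <;> omega, h.symm⟩
    · exact ⟨i, hi.trans_le hj, 1, by rw [hget i (hi.trans_le hj), if_pos hi]; omega, h.symm⟩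

end Stars

/-- Grundy values of the 0.33 game on stars with an even number `k ≥ 4` of arms,
`j` of which have 2 vertices and `k - j` of which have 1 vertex. -/
theorem grundy_star_even_arms (k j : ℕ) (hk : 4 ≤ k) (hke : k % 2 = 0) (hj : j ≤ k) :
    starGrundy (List.replicate j 2 ++ List.replicate (k - j) 1) =
      if j = 0 then 0
      else if j = 1 then 3
      else if j = 2 then 1
      else if j = 3 then 2
      else if j % 2 = 0 then 0 else 3 := by
  have hsub : Finset.range j ⊆ Finset.range k := Finset.range_subset_range.2 hj
  have h := grundy_starVerts hsub (by simp; omega)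
  rw [starGrundy, bistarGrundy, bistarGrundyO, bistarVerts_replicate hj, h]
  simp only [Finset.card_range, starValue]
  rw [if_neg (by omega), if_pos hke]
end
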